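/- For all h, k ≥ 0 with (h,k) ≠ (2,2), the word 1^h 0^k (h ones followed by k zeros) is tilde-isometric; the word 1100 (the case h = k = 2) is tilde-non-isometric. -/

import Mathlib

/-- One tilde edit step: a replacement (flip one symbol) or a swap of two
adjacent distinct symbols. -/
inductive TStep : List Bool → List Bool → Prop
  | repl (x y : List Bool) (a : Bool) : TStep (x ++ a :: y) (x ++ (!a) :: y)
  | swap (x y : List Bool) (a : Bool) : TStep (x ++ a :: (!a) :: y) (x ++ (!a) :: a :: y)

/-- `reach step h u v` : `v` can be obtained from `u` by a chain of `h` steps. -/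
def reach (step : List Bool → List Bool → Prop) : ℕ → List Bool → List Bool → Prop
  | 0 => Eq
  | h + 1 => fun u v => ∃ w, step u w ∧ reach step h w v

/-- The tilde-distance: the minimum number of replacements and swaps needed to
transform `u` into `v`. -/
noncomputable def tildeDist (u v : List Bool) : ℕ := sInf {h | reach TStep h u v}

theorem TStep.symm {u v : List Bool} (h : TStep u v) : TStep v u := by
  cases h with
  | repl x y a => simpa using TStep.repl x y (!a)
  | swap x y a => simpa using TStep.swap x y (!a)

theorem reach_snoc {step : List Bool → List Bool → Prop} :
    ∀ {h : ℕ} {u v w : List Bool}, reach step h u v → step v w → reach step (h + 1) u w := by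
  intro h
  induction h with
  | zero => intro u v w r s; exact ⟨w, r ▸ s, rfl⟩
  | succ h ih => intro u v w r s; obtain ⟨z, su, rz⟩ := r; exact ⟨z, su, ih rz s⟩

theorem reach_symm : ∀ {h : ℕ} {u v : List Bool}, reach TStep h u v → reach TStep h v u := by
  intro h
  induction h with
  | zero => intro u v r; exact r.symm
  | succ h ih => intro u v r; obtain ⟨w, s, rw⟩ := r; exact reach_snoc (ih rw) s.symm

theorem tildeDist_comm (u v : List Bool) : tildeDist u v = tildeDist v u := by
  unfold tildeDist
  congr 1
  ext h
  exact ⟨fun r => reach_symm r, fun r => reach_symm r⟩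

theorem tildeDist_self (u : List Bool) : tildeDist u u = 0 :=
  Nat.sInf_eq_zero.mpr (Or.inl rfl)

/-- The Hamming distance: the number of positions at which `u` and `v` differ. -/
def hammDist (u v : List Bool) : ℕ := ((u.zip v).filter fun p => p.1 != p.2).length

theorem hammDist_comm : ∀ u v : List Bool, hammDist u v = hammDist v u
  | [], [] => rfl
  | [], _ :: _ => rfl
  | _ :: _, [] => rfl
  | a :: u, b :: v => by
    cases a <;> cases b <;>
      simp [hammDist, List.filter_cons, hammDist_comm u v, hammDist] <;>
      simpa [hammDist] using hammDist_comm u v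

theorem hammDist_self : ∀ u : List Bool, hammDist u u = 0
  | [] => rfl
  | a :: u => by simpa [hammDist, List.filter_cons] using hammDist_self u

/-- Binary words of length `n`. -/
abbrev Word (n : ℕ) := {w : List Bool // w.length = n}

/-- The `n`-tilde-hypercube: vertices are the binary words of length `n`, and
two vertices are adjacent iff their tilde-distance is `1`. -/
noncomputable def tildeCube (n : ℕ) : SimpleGraph (Word n) where
  Adj u v := tildeDist u.val v.val = 1
  symm := ⟨by intro u v h; rwa [tildeDist_comm]⟩
  loopless := ⟨by intro u h; rw [tildeDist_self] at h; exact one_ne_zero h.symm⟩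

/-- The `n`-hypercube: vertices are the binary words of length `n`, and
two vertices are adjacent iff their Hamming distance is `1`. -/
def hamCube (n : ℕ) : SimpleGraph (Word n) where
  Adj u v := hammDist u.val v.val = 1
  symm := ⟨by intro u v h; rwa [hammDist_comm]⟩
  loopless := ⟨by intro u h; rw [hammDist_self] at h; exact one_ne_zero h.symm⟩

/-- `f` is tilde-isometric. -/
def TildeIsometric (f : List Bool) : Prop :=
  ∀ n : ℕ, f.length ≤ n → ∀ u v : List Bool, u.length = n → v.length = n →
    ¬ f <:+: u → ¬ f <:+: v →
    ∃ w : ℕ → List Bool, w 0 = u ∧ w (tildeDist u v) = v ∧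
      (∀ k < tildeDist u v, tildeDist (w k) (w (k + 1)) = 1) ∧
      (∀ k ≤ tildeDist u v, ¬ f <:+: w k)

/-- `f` is Ham-isometric. -/
def HamIsometric (f : List Bool) : Prop :=
  ∀ u v : List Bool, u.length = v.length →
    ¬ f <:+: u → ¬ f <:+: v →
    ∃ w : ℕ → List Bool, w 0 = u ∧ w (hammDist u v) = v ∧
      (∀ k ≤ hammDist u v, (w k).length = u.length) ∧
      (∀ k < hammDist u v, hammDist (w k) (w (k + 1)) = 1) ∧
      (∀ k ≤ hammDist u v, ¬ f <:+: w k)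
/-- The set of words of length `n` avoiding the factor `11`. -/
def fibFree (n : ℕ) : Set (Word n) := {w | ¬ [true, true] <:+: w.val}

/-- The `n`-tilde-Fibonacci cube: the subgraph of the tilde-hypercube induced by
the words avoiding the factor `11`. -/
noncomputable def tildeFibCube (n : ℕ) : SimpleGraph (fibFree n) :=
  (tildeCube n).induce (fibFree n)

/-- The `n`-Fibonacci cube: the subgraph of the hypercube induced by
the words avoiding the factor `11`. -/
def fibCube (n : ℕ) : SimpleGraph (fibFree n) :=
  (hamCube n).induce (fibFree n)

/-- `1^h 0^k` occurs at index `j` of the (partial) word `g`. -/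
def Occ (h k : ℕ) (g : ℕ → Option Bool) (j : ℕ) : Prop :=
  (∀ t, j ≤ t → t < j + h → g t = some true) ∧
  (∀ t, j + h ≤ t → t < j + h + k → g t = some false)

/-- If a modification of `U` at one place to `false` creates an occurrence, it covers it. -/
theorem occ_flip_false {h k i : ℕ} {U U' : ℕ → Option Bool} (hU'i : U' i = some false)
    (hU' : ∀ t, t ≠ i → U' t = U t) (nU : ∀ j, ¬ Occ h k U j) {j : ℕ} (o : Occ h k U' j) :
    j + h ≤ i ∧ i < j + h + k := by
  by_contra hc
  apply nU j
  obtain ⟨o1, o2⟩ := o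
  refine ⟨fun t h1 h2 => ?_, fun t h1 h2 => ?_⟩
  · by_cases e : t = i
    · have := o1 t h1 h2; rw [e, hU'i] at this; simp at this
    · rw [← hU' t e]; exact o1 t h1 h2
  · rw [← hU' t (by omega)]; exact o2 t h1 h2

theorem occ_flip_true {h k i : ℕ} {U U' : ℕ → Option Bool} (hU'i : U' i = some true)
    (hU' : ∀ t, t ≠ i → U' t = U t) (nU : ∀ j, ¬ Occ h k U j) {j : ℕ} (o : Occ h k U' j) :
    j ≤ i ∧ i < j + h := by
  by_contra hc
  apply nU j
  obtain ⟨o1, o2⟩ := o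
  refine ⟨fun t h1 h2 => ?_, fun t h1 h2 => ?_⟩
  · rw [← hU' t (by omega)]; exact o1 t h1 h2
  · by_cases e : t = i
    · have := o2 t h1 h2; rw [e, hU'i] at this; simp at this
    · rw [← hU' t e]; exact o2 t h1 h2

theorem core1 {h k i : ℕ} (hh : 1 ≤ h) (hk : 1 ≤ k) {U V U' V' : ℕ → Option Bool}
    (agree : ∀ t, t < i → U t = V t) (hUi : U i = some true) (hVi : V i = some false)
    (hU'i : U' i = some false) (hU' : ∀ t, t ≠ i → U' t = U t)
    (hV'i : V' i = some true) (hV' : ∀ t, t ≠ i → V' t = V t)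
    (nU : ∀ j, ¬ Occ h k U j) (nV : ∀ j, ¬ Occ h k V j)
    (nalt : ¬ (U (i+1) = some false ∧ V (i+1) = some true)) :
    (∀ j, ¬ Occ h k U' j) ∨ ∀ j, ¬ Occ h k V' j := by
  by_contra hc
  push Not at hc
  obtain ⟨⟨j, oj⟩, ⟨l, ol⟩⟩ := hc
  obtain ⟨b1, b2⟩ := occ_flip_false hU'i hU' nU oj
  obtain ⟨c1, c2⟩ := occ_flip_true hV'i hV' nV ol
  obtain ⟨u1, u2⟩ := oj
  obtain ⟨v1, v2⟩ := ol
  by_cases e1 : j + h = i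
  · apply nV j
    refine ⟨fun t h1 h2 => ?_, fun t h1 h2 => ?_⟩
    · grind
    · by_cases e2 : l + h = i + 1
      · grind
      · have := v1 (i+1) (by omega) (by omega)
        have := u2 (i+1)
        grind
  · have e3 : l = i := by
      by_contra hne
      have := v1 (i-1) (by omega) (by omega)
      have := u2 (i-1) (by omega) (by omega)
      grind
    apply nV j
    refine ⟨fun t h1 h2 => ?_, fun t h1 h2 => ?_⟩
    · grind
    · have := v1 (i+1)
      have := u2 (i+1)
      have := v2 t
      grind

/-- Swap in `U` : `10 → 01` at `i`. -/
theorem core_swapU {h k i : ℕ} (hk : 1 ≤ k) {U V U' : ℕ → Option Bool}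
    (agree : ∀ t, t < i → U t = V t) (hVi : V i = some false)
    (hU'i : U' i = some false) (hU'i1 : U' (i+1) = some true)
    (hU' : ∀ t, t ≠ i → t ≠ i + 1 → U' t = U t)
    (nU : ∀ j, ¬ Occ h k U j) (nV : ∀ j, ¬ Occ h k V j) {j : ℕ} (oj : Occ h k U' j) :
    1 ≤ h ∧ j = i + 1 := by
  obtain ⟨u1, u2⟩ := oj
  have a1 := u1 i
  have a2 := u2 i
  have a3 := u1 (i+1)
  have a4 := u2 (i+1)
  by_contra hc
  have : j + h + k = i + 1 ∨ (j + h + k ≤ i ∨ i + 2 ≤ j) := by grind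
  rcases this with e | e
  · apply nV j
    refine ⟨fun t h1 h2 => ?_, fun t h1 h2 => ?_⟩
    · grind
    · grind
  · apply nU j
    refine ⟨fun t h1 h2 => ?_, fun t h1 h2 => ?_⟩
    · grind
    · grind

/-- Swap in `V` : `01 → 10` at `i`. -/
theorem core_swapV {h k i : ℕ} (hh : 1 ≤ h) {U V V' : ℕ → Option Bool}
    (agree : ∀ t, t < i → U t = V t) (hUi : U i = some true)
    (hV'i : V' i = some true) (hV'i1 : V' (i+1) = some false)
    (hV' : ∀ t, t ≠ i → t ≠ i + 1 → V' t = V t)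
    (nU : ∀ j, ¬ Occ h k U j) (nV : ∀ j, ¬ Occ h k V j) {j : ℕ} (oj : Occ h k V' j) :
    1 ≤ k ∧ j + h = i + 1 := by
  obtain ⟨u1, u2⟩ := oj
  have a1 := u1 i
  have a2 := u2 i
  have a3 := u1 (i+1)
  have a4 := u2 (i+1)
  by_contra hc
  have : (k = 0 ∧ j + h = i + 1) ∨ (j + h + k ≤ i ∨ i + 2 ≤ j) := by grind
  rcases this with e | e
  · apply nU j
    refine ⟨fun t h1 h2 => ?_, fun t h1 h2 => ?_⟩
    · grind
    · grind
  · apply nV j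
    refine ⟨fun t h1 h2 => ?_, fun t h1 h2 => ?_⟩
    · grind
    · grind

theorem core2 {h k i : ℕ} (hh : 1 ≤ h) (hk : 1 ≤ k) (h22 : ¬ (h = 2 ∧ k = 2))
    {U V U' V' : ℕ → Option Bool}
    (agree : ∀ t, t < i → U t = V t) (hUi : U i = some true) (hVi : V i = some false)
    (hUi1 : U (i+1) = some false) (hVi1 : V (i+1) = some true)
    (hU'i : U' i = some false) (hU'i1 : U' (i+1) = some true)
    (hU' : ∀ t, t ≠ i → t ≠ i + 1 → U' t = U t)
    (hV'i : V' i = some true) (hV'i1 : V' (i+1) = some false)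
    (hV' : ∀ t, t ≠ i → t ≠ i + 1 → V' t = V t)
    (nU : ∀ j, ¬ Occ h k U j) (nV : ∀ j, ¬ Occ h k V j)
    (bU : ¬ ∀ j, ¬ Occ h k U' j) (bV : ¬ ∀ j, ¬ Occ h k V' j) :
    2 ≤ h ∧ 2 ≤ k ∧ U (i+2) = some true ∧ V (i+2) = some false ∧
      ¬ (U (i+3) = some false ∧ V (i+3) = some true) ∧ U (i-1) = some true ∧ 1 ≤ i ∧
      (3 ≤ h → U (i+3) = some true) := by
  push Not at bU bV
  obtain ⟨j, oj⟩ := bU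
  obtain ⟨l, ol⟩ := bV
  obtain ⟨-, e1⟩ := core_swapU hk agree hVi hU'i hU'i1 hU' nU nV oj
  obtain ⟨-, e2⟩ := core_swapV hh agree hUi hV'i hV'i1 hV' nU nV ol
  obtain ⟨u1, u2⟩ := oj
  obtain ⟨v1, v2⟩ := ol
  subst e1
  have k2 : 2 ≤ k := by
    by_contra hc
    apply nU l
    refine ⟨fun t h1 h2 => ?_, fun t h1 h2 => ?_⟩
    · grind
    · have : t = i + 1 := by omega
      grind
  have h2 : 2 ≤ h := by
    by_contra hc
    apply nU i
    refine ⟨fun t h1 h2 => ?_, fun t h1 h2 => ?_⟩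
    · have : t = i := by omega
      grind
    · grind
  have x1 : U (i+2) = some true := by
    rw [← hU' _ (by omega) (by omega)]; exact u1 _ (by omega) (by omega)
  have x2 : V (i+2) = some false := by
    rw [← hV' _ (by omega) (by omega)]; exact v2 _ (by omega) (by omega)
  have x3 : 3 ≤ h → U (i+3) = some true := by
    intro h3
    rw [← hU' _ (by omega) (by omega)]; exact u1 _ (by omega) (by omega)
  have x4 : 3 ≤ k → V (i+3) = some false := by
    intro h3
    rw [← hV' _ (by omega) (by omega)]; exact v2 _ (by omega) (by omega)
  refine ⟨h2, k2, x1, x2, ?_, ?_, by omega, x3⟩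
  · rintro ⟨y1, y2⟩
    have : 3 ≤ h ∨ 3 ≤ k := by omega
    rcases this with h3 | h3
    · simp [x3 h3] at y1
    · simp [x4 h3] at y2
  · rw [agree _ (by omega), ← hV' _ (by omega) (by omega)]; exact v1 _ (by omega) (by omega)

theorem core3 {h k i : ℕ} (h2 : 2 ≤ h) (hk : 2 ≤ k) (h22 : ¬ (h = 2 ∧ k = 2))
    {U V U' V' V'' : ℕ → Option Bool} (i1 : 1 ≤ i)
    (hUi0 : U (i-1) = some true)
    (hUi2 : U (i+2) = some true) (hVi2 : V (i+2) = some false)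
    (hVi : V i = some false) (hVi1 : V (i+1) = some true)
    (hU'i : U' i = some false) (hU' : ∀ t, t ≠ i → U' t = U t)
    (hV'i : V' i = some true) (hV' : ∀ t, t ≠ i → V' t = V t)
    (hV''i : V'' (i+2) = some true) (hV'' : ∀ t, t ≠ i+2 → V'' t = V t)
    (nU : ∀ j, ¬ Occ h k U j) (nV : ∀ j, ¬ Occ h k V j) :
    (∀ j, ¬ Occ h k U' j) ∨ (∀ j, ¬ Occ h k V' j) ∨ ∀ j, ¬ Occ h k V'' j := by
  by_contra hc
  push Not at hc
  obtain ⟨⟨j, oj⟩, ⟨l, ol⟩, ⟨m, om⟩⟩ := hc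
  obtain ⟨b1, b2⟩ := occ_flip_false hU'i hU' nU oj
  obtain ⟨c1, c2⟩ := occ_flip_true hV'i hV' nV ol
  obtain ⟨d1, d2⟩ := occ_flip_true hV''i hV'' nV om
  obtain ⟨u1, u2⟩ := oj
  obtain ⟨v1, v2⟩ := ol
  obtain ⟨w1, w2⟩ := om
  have := u2 (i-1)
  have := u2 (i+2)
  have k2 : k = 2 := by grind
  have e : l + h = i + 2 := by
    have := v1 (i+2)
    have := v2 (i+1)
    grind
  have := v2 (i+3) (by omega) (by omega)
  have := w1 (i+3)
  have := w1 i
  grind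

theorem infix_iff_occ (h k : ℕ) (w : List Bool) :
    (List.replicate h true ++ List.replicate k false) <:+: w ↔ ∃ j, Occ h k (fun t => w[t]?) j := by
  rw [List.infix_iff_getElem?]
  constructor
  · rintro ⟨j, h1, h2⟩
    refine ⟨j, fun t a b => ?_, fun t a b => ?_⟩
    · have := h2 (t - j) (by simp; omega)
      rw [Nat.sub_add_cancel a, List.getElem_append_left (by simp; omega)] at this
      simpa using this
    · have := h2 (t - j) (by simp; omega)
      rw [Nat.sub_add_cancel (by omega), List.getElem_append_right (by simp; omega)] at this
      simpa using this
  · rintro ⟨j, o1, o2⟩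
    by_cases e : h + k = 0
    · refine ⟨0, by simp; omega, fun i hi => ?_⟩
      simp at hi; omega
    · refine ⟨j, ?_, fun i hi => ?_⟩
      · have a1 := o1 (j + h + k - 1)
        have a2 := o2 (j + h + k - 1)
        simp only [List.length_append, List.length_replicate]
        by_cases k0 : k = 0
        · have := (List.getElem?_eq_some_iff.mp (a1 (by omega) (by omega))).1
          omega
        · have := (List.getElem?_eq_some_iff.mp (a2 (by omega) (by omega))).1
          omega
      · simp only [List.length_append, List.length_replicate] at hi
        by_cases c : i < h
        · rw [List.getElem_append_left (by simpa using c)]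
          simpa using o1 (i + j) (by omega) (by omega)
        · rw [List.getElem_append_right (by simpa using c)]
          simpa using o2 (i + j) (by omega) (by omega)

/-- Greedy computation of the tilde-distance. The state remembers a pending mismatch. -/
def gE : Option Bool → List Bool → List Bool → ℕ
  | _, [], _ => 0
  | _, _ :: _, [] => 0
  | s, a :: u, b :: v =>
    if a = b then gE none u v else if s = some a then gE none u v else 1 + gE (some (!a)) u v

theorem gE_state : ∀ (u v : List Bool) (x : Bool),
    gE (some x) u v ≤ gE none u v ∧ gE none u v ≤ gE (some x) u v + 1
  | [], _, _ => by simp [gE]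
  | _ :: _, [], _ => by simp [gE]
  | a :: u, b :: v, x => by
    have h1 := gE_state u v true
    have h2 := gE_state u v false
    cases a <;> cases b <;> cases x <;> simp [gE] <;> omega

theorem gE_symm : ∀ (u v : List Bool) (s : Option Bool), gE s u v = gE (s.map not) v u
  | [], [], _ => by simp [gE]
  | [], _ :: _, _ => by simp [gE]
  | _ :: _, [], _ => by simp [gE]
  | a :: u, b :: v, s => by
    have h1 := gE_symm u v none
    have h2 := gE_symm u v (some true)
    have h3 := gE_symm u v (some false)
    rcases s with _ | s
    · cases a <;> cases b <;> simp_all [gE]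
    · cases a <;> cases b <;> cases s <;> simp_all [gE]

theorem gE_self : ∀ (u : List Bool) (s : Option Bool), gE s u u = 0
  | [], _ => by simp [gE]
  | a :: u, s => by simp [gE, gE_self u]

theorem gE_prefix : ∀ (p u v : List Bool), gE none (p ++ u) (p ++ v) = gE none u v
  | [], _, _ => rfl
  | a :: p, u, v => by simp [gE, gE_prefix p]

theorem gE_repl : ∀ (x y v : List Bool) (a : Bool) (s : Option Bool),
    gE s (x ++ a :: y) v ≤ gE s (x ++ (!a) :: y) v + 1
  | _, _, [], _, _ => by
    rename_i x y a s
    cases x <;> simp [gE]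
  | [], y, b :: v, a, s => by
    have h1 := gE_state y v true
    have h2 := gE_state y v false
    rcases s with _ | s
    · cases a <;> cases b <;> simp [gE] <;> omega
    · cases a <;> cases b <;> cases s <;> simp [gE] <;> omega
  | c :: x, y, b :: v, a, s => by
    have h1 := gE_repl x y v a none
    have h2 := gE_repl x y v a (some (!c))
    simp only [List.cons_append, gE]
    split_ifs <;> omega

theorem gE_swap : ∀ (x y v : List Bool) (a : Bool) (s : Option Bool),
    gE s (x ++ a :: (!a) :: y) v ≤ gE s (x ++ (!a) :: a :: y) v + 1
  | _, _, [], _, _ => by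
    rename_i x y a s
    cases x <;> simp [gE]
  | [], y, [b], a, s => by
    rcases s with _ | s
    · cases a <;> cases b <;> simp [gE]
    · cases a <;> cases b <;> cases s <;> simp [gE]
  | [], y, b :: c :: v, a, s => by
    have h1 := gE_state y v true
    have h2 := gE_state y v false
    rcases s with _ | s
    · cases a <;> cases b <;> cases c <;> simp [gE] <;> omega
    · cases a <;> cases b <;> cases c <;> cases s <;> simp [gE] <;> omega
  | c :: x, y, b :: v, a, s => by
    have h1 := gE_swap x y v a none
    have h2 := gE_swap x y v a (some (!c))
    simp only [List.cons_append, gE]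
    split_ifs <;> omega

theorem gE_step {u w : List Bool} (v : List Bool) (h : TStep u w) :
    gE none u v ≤ gE none w v + 1 := by
  cases h with
  | repl x y a => exact gE_repl x y v a none
  | swap x y a => exact gE_swap x y v a none

theorem gE_le_of_reach : ∀ {n : ℕ} {u v : List Bool}, reach TStep n u v → gE none u v ≤ n := by
  intro n
  induction n with
  | zero => intro u v r; cases r; simp [gE_self]
  | succ n ih =>
    intro u v r
    obtain ⟨w, s, r⟩ := r
    have := gE_step v s
    have := ih r
    omega

theorem TStep.len {u v : List Bool} (h : TStep u v) : u.length = v.length := by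
  cases h <;> simp

theorem TStep.ne {u v : List Bool} (h : TStep u v) : u ≠ v := by
  cases h <;> simp

theorem TStep.dist {u v : List Bool} (h : TStep u v) : tildeDist u v = 1 := by
  have hm : 1 ∈ {n | reach TStep n u v} := ⟨v, h, rfl⟩
  have h1 : tildeDist u v ≤ 1 := Nat.sInf_le hm
  have h2 : tildeDist u v ≠ 0 := by
    intro e
    have : tildeDist u v ∈ {n | reach TStep n u v} := Nat.sInf_mem ⟨1, hm⟩
    rw [e] at this
    exact h.ne this
  omega

theorem dist_eq {u v : List Bool} (r : reach TStep (gE none u v) u v) :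
    tildeDist u v = gE none u v := by
  apply le_antisymm
  · exact Nat.sInf_le r
  · exact gE_le_of_reach (Nat.sInf_mem (s := {n | reach TStep n u v}) ⟨_, r⟩)

theorem first_mismatch : ∀ (u v : List Bool), u.length = v.length → u ≠ v →
    ∃ p x y a, u = p ++ a :: x ∧ v = p ++ (!a) :: y
  | [], [], _, h => by simp at h
  | [], _ :: _, h, _ => by simp at h
  | _ :: _, [], h, _ => by simp at h
  | a :: u, b :: v, hl, hn => by
    by_cases e : a = b
    · subst e
      obtain ⟨p, x, y, c, rfl, rfl⟩ := first_mismatch u v (by simpa using hl) (by simpa using hn)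
      exact ⟨a :: p, x, y, c, rfl, rfl⟩
    · refine ⟨[], u, v, a, rfl, ?_⟩
      cases a <;> cases b <;> simp_all

/-- The word `f = 1^h 0^k`. -/
abbrev ff (h k : ℕ) : List Bool := List.replicate h true ++ List.replicate k false

/-- There is a closer `f`-free neighbour. -/
def Good (f u v : List Bool) : Prop :=
  (∃ w, TStep u w ∧ ¬ f <:+: w ∧ gE none u v = gE none w v + 1) ∨
  (∃ w, TStep v w ∧ ¬ f <:+: w ∧ gE none u v = gE none u w + 1)

theorem Good.symm {f u v : List Bool} (g : Good f u v) : Good f v u := by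
  rcases g with ⟨w, a, b, c⟩ | ⟨w, a, b, c⟩
  · refine Or.inr ⟨w, a, b, ?_⟩
    rw [gE_symm v u, gE_symm v w]; exact c
  · refine Or.inl ⟨w, a, b, ?_⟩
    rw [gE_symm v u, gE_symm w u]; exact c

theorem step_path {f : List Bool} (hg : ∀ u v : List Bool, u.length = v.length → u ≠ v →
    ¬ f <:+: u → ¬ f <:+: v → Good f u v) :
    ∀ (n : ℕ) (u v : List Bool), u.length = v.length → ¬ f <:+: u → ¬ f <:+: v →
    gE none u v = n → reach (fun a b => TStep a b ∧ ¬ f <:+: a ∧ ¬ f <:+: b) n u v := by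
  intro n
  induction n with
  | zero =>
    intro u v hl hu hv e
    by_contra hne
    rcases hg u v hl hne hu hv with ⟨w, a, b, c⟩ | ⟨w, a, b, c⟩ <;> omega
  | succ n ih =>
    intro u v hl hu hv e
    have hne : u ≠ v := by
      rintro rfl
      simp [gE_self] at e
    rcases hg u v hl hne hu hv with ⟨w, a, b, c⟩ | ⟨w, a, b, c⟩
    · exact ⟨w, ⟨a, hu, b⟩, ih w v (by rw [← a.len, hl]) b hv (by omega)⟩
    · exact reach_snoc (ih u w (by rw [← a.len, hl]) hu b (by omega)) ⟨a.symm, b, hv⟩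

theorem reach_mono {s t : List Bool → List Bool → Prop} (hst : ∀ a b, s a b → t a b) :
    ∀ {n : ℕ} {u v : List Bool}, reach s n u v → reach t n u v := by
  intro n
  induction n with
  | zero => intro u v r; exact r
  | succ n ih => rintro u v ⟨w, a, r⟩; exact ⟨w, hst _ _ a, ih r⟩

theorem reach_fun {s : List Bool → List Bool → Prop} :
    ∀ {n : ℕ} {u v : List Bool}, reach s n u v →
    ∃ w : ℕ → List Bool, w 0 = u ∧ w n = v ∧ ∀ k < n, s (w k) (w (k+1)) := by
  intro n
  induction n with
  | zero => intro u v r; exact ⟨fun _ => u, rfl, r, by simp⟩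
  | succ n ih =>
    rintro u v ⟨z, a, r⟩
    obtain ⟨w, h0, hn, hs⟩ := ih r
    refine ⟨fun k => Nat.casesOn k u w, rfl, hn, ?_⟩
    intro k hk
    cases k with
    | zero => simpa [h0] using a
    | succ k => exact hs k (by omega)

theorem iso_of_good {f : List Bool} (hg : ∀ u v : List Bool, u.length = v.length → u ≠ v →
    ¬ f <:+: u → ¬ f <:+: v → Good f u v) : TildeIsometric f := by
  intro n _ u v hu hv fu fv
  have r := step_path hg _ u v (by rw [hu, hv]) fu fv rfl
  rw [← dist_eq (reach_mono (fun a b h => h.1) r)] at r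
  obtain ⟨w, h0, h1, hs⟩ := reach_fun r
  refine ⟨w, h0, h1, fun k hk => (hs k hk).1.dist, fun k hk => ?_⟩
  cases k with
  | zero => rwa [h0]
  | succ k => exact (hs k hk).2.2

/-- All candidates for a single step. -/
def nbrs : List Bool → List (List Bool)
  | [] => []
  | [a] => [[!a]]
  | a :: b :: u => ((!a) :: b :: u) :: (b :: a :: u) :: (nbrs (b :: u)).map (a :: ·)

theorem mem_nbrs_cons (c : Bool) {u w : List Bool} (h : w ∈ nbrs u) : c :: w ∈ nbrs (c :: u) := by
  cases u with
  | nil => simp [nbrs] at h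
  | cons b u => simp [nbrs, h]

theorem TStep.mem {u w : List Bool} (h : TStep u w) : w ∈ nbrs u := by
  cases h with
  | repl x y a =>
    induction x with
    | nil => cases y <;> simp [nbrs]
    | cons c x ih => exact mem_nbrs_cons c ih
  | swap x y a =>
    induction x with
    | nil => simp [nbrs]
    | cons c x ih => exact mem_nbrs_cons c ih

theorem step_of_dist {u v : List Bool} (h : tildeDist u v = 1) : TStep u v := by
  have hne : {n | reach TStep n u v}.Nonempty := by
    by_contra hc
    rw [Set.not_nonempty_iff_eq_empty] at hc
    simp [tildeDist, hc] at h
  have : tildeDist u v ∈ {n | reach TStep n u v} := Nat.sInf_mem hne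
  rw [h] at this
  obtain ⟨w, s, e⟩ := this
  cases e
  exact s

theorem not_iso : ¬ TildeIsometric [true, true, false, false] := by
  intro H
  have d : tildeDist [true, true, false, true, false, false]
      [true, false, true, false, true, false] = 2 := by
    refine dist_eq (u := [true, true, false, true, false, false])
      (v := [true, false, true, false, true, false]) ?_
    exact ⟨_, TStep.swap [true] [true, false, false] true, _,
      TStep.swap [true, false, true] [false] true, rfl⟩
  obtain ⟨w, h0, h2, hs, hf⟩ := H 6 (by simp) [true, true, false, true, false, false]
    [true, false, true, false, true, false] rfl rfl (by decide) (by decide)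
  rw [d] at h2 hs hf
  have s1 := (step_of_dist (hs 0 (by norm_num))).mem
  have s2 := (step_of_dist (hs 1 (by norm_num))).symm.mem
  simp only [zero_add, h0] at s1
  norm_num [h2] at s2
  have key : ∀ x ∈ nbrs [true, true, false, true, false, false],
      x ∈ nbrs [true, false, true, false, true, false] → [true, true, false, false] <:+: x := by
    decide
  exact hf 1 (by norm_num) (key _ s1 s2)

theorem get_at (p x : List Bool) (a : Bool) : (p ++ a :: x)[p.length]? = some a := by simp

theorem get_at1 (p x : List Bool) (a b : Bool) : (p ++ a :: b :: x)[p.length + 1]? = some b := by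
  simp [List.getElem?_append_right]

theorem get_tail (p x : List Bool) (a : Bool) (n : ℕ) :
    (p ++ a :: x)[p.length + (n + 1)]? = x[n]? := by
  simp [List.getElem?_append_right]

theorem get_ne (p x : List Bool) (a b : Bool) (t : ℕ) (ht : t ≠ p.length) :
    (p ++ a :: x)[t]? = (p ++ b :: x)[t]? := by
  rcases lt_or_gt_of_ne ht with c | c
  · rw [List.getElem?_append_left c, List.getElem?_append_left c]
  · obtain ⟨n, rfl⟩ := Nat.exists_eq_add_of_lt c
    rw [add_assoc, get_tail, get_tail]

theorem get_ne2 (p x : List Bool) (a b c d : Bool) (t : ℕ) (ht : t ≠ p.length)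
    (ht1 : t ≠ p.length + 1) :
    (p ++ a :: b :: x)[t]? = (p ++ c :: d :: x)[t]? := by
  rw [get_ne p _ a c t ht]
  have := get_ne (p ++ [c]) x b d t (by simpa using ht1)
  simpa using this

theorem get_lt (p x y : List Bool) (t : ℕ) (ht : t < p.length) :
    (p ++ x)[t]? = (p ++ y)[t]? := by
  rw [List.getElem?_append_left ht, List.getElem?_append_left ht]

theorem gE_nonalt (x y : List Bool) (h : ¬ (x[0]? = some false ∧ y[0]? = some true)) :
    gE (some false) x y = gE none x y := by
  cases x with
  | nil => simp [gE]
  | cons a x =>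
    cases y with
    | nil => simp [gE]
    | cons b y => cases a <;> cases b <;> simp_all [gE]

theorem good_main {h k : ℕ} (h22 : ¬ (h = 2 ∧ k = 2)) (p x y : List Bool)
    (nu : ¬ ff h k <:+: (p ++ true :: x)) (nv : ¬ ff h k <:+: (p ++ false :: y)) :
    Good (ff h k) (p ++ true :: x) (p ++ false :: y) := by
  unfold Good
  rw [infix_iff_occ, not_exists] at nu nv
  simp only [infix_iff_occ, not_exists]
  have h00 : 1 ≤ h ∨ 1 ≤ k := by
    by_contra hc
    apply nu 0
    exact ⟨fun t a b => by omega, fun t a b => by omega⟩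
  by_cases alt : x[0]? = some false ∧ y[0]? = some true
  · obtain ⟨x, rfl⟩ : ∃ x', x = false :: x' := by cases x <;> simp_all
    obtain ⟨y, rfl⟩ : ∃ y', y = true :: y' := by cases y <;> simp_all
    have sU : TStep (p ++ true :: false :: x) (p ++ false :: true :: x) := TStep.swap p x true
    have sV : TStep (p ++ false :: true :: y) (p ++ true :: false :: y) := TStep.swap p y false
    by_cases bU : ∀ j, ¬ Occ h k (fun t => (p ++ false :: true :: x)[t]?) j
    · exact Or.inl ⟨_, sU, bU, by simp [gE_prefix, gE]; omega⟩
    by_cases bV : ∀ j, ¬ Occ h k (fun t => (p ++ true :: false :: y)[t]?) j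
    · exact Or.inr ⟨_, sV, bV, by simp [gE_prefix, gE]; omega⟩
    have hh : 1 ≤ h := by
      by_contra hc
      apply bU
      intro j oj
      have := core_swapU (i := p.length) (V := fun t => (p ++ false :: true :: y)[t]?)
        (U := fun t => (p ++ true :: false :: x)[t]?) (by omega)
        (fun t ht => get_lt p _ _ t ht) (get_at _ _ _) (get_at _ _ _) (get_at1 _ _ _ _)
        (fun t a b => get_ne2 _ _ _ _ _ _ t a b) nu nv oj
      omega
    have hk : 1 ≤ k := by
      by_contra hc
      apply bV
      intro j oj
      have := core_swapV (i := p.length) (V := fun t => (p ++ false :: true :: y)[t]?)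
        (U := fun t => (p ++ true :: false :: x)[t]?) (by omega)
        (fun t ht => get_lt p _ _ t ht) (get_at _ _ _) (get_at _ _ _) (get_at1 _ _ _ _)
        (fun t a b => get_ne2 _ _ _ _ _ _ t a b) nu nv oj
      omega
    obtain ⟨h2, k2, x1, x2, x3, x4, x5, x6⟩ := core2 (i := p.length) hh hk h22
      (V := fun t => (p ++ false :: true :: y)[t]?)
      (U := fun t => (p ++ true :: false :: x)[t]?)
      (fun t ht => get_lt p _ _ t ht) (get_at _ _ _) (get_at _ _ _) (get_at1 _ _ _ _)
      (get_at1 _ _ _ _) (get_at _ _ _) (get_at1 _ _ _ _)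
      (fun t a b => get_ne2 _ _ _ _ _ _ t a b) (get_at _ _ _) (get_at1 _ _ _ _)
      (fun t a b => get_ne2 _ _ _ _ _ _ t a b) nu nv bU bV
    have y1 := x1
    have y2 := x2
    simp only [get_tail, List.getElem?_cons_succ] at y1 y2 x3
    obtain ⟨x, rfl⟩ : ∃ x', x = true :: x' := by cases x <;> simp_all
    obtain ⟨y, rfl⟩ : ∃ y', y = false :: y' := by cases y <;> simp_all
    simp only [List.getElem?_cons_succ] at x3
    have e1 := gE_nonalt x y x3
    have t1 : TStep (p ++ true :: false :: true :: x) (p ++ false :: false :: true :: x) :=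
      TStep.repl p _ true
    have t2 : TStep (p ++ false :: true :: false :: y) (p ++ true :: true :: false :: y) :=
      TStep.repl p _ false
    have t3 : TStep (p ++ false :: true :: false :: y) (p ++ false :: true :: true :: y) := by
      simpa using TStep.repl (p ++ [false, true]) y false
    have g3 : ∀ t, t ≠ p.length + 2 → (p ++ false :: true :: true :: y)[t]? =
        (p ++ false :: true :: false :: y)[t]? := by
      intro t ht
      simpa using get_ne (p ++ [false, true]) y true false t (by simpa using ht)
    rcases core3 (i := p.length) h2 k2 h22
      (V := fun t => (p ++ false :: true :: false :: y)[t]?)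
      (U := fun t => (p ++ true :: false :: true :: x)[t]?)
      (U' := fun t => (p ++ false :: false :: true :: x)[t]?)
      (V' := fun t => (p ++ true :: true :: false :: y)[t]?)
      (V'' := fun t => (p ++ false :: true :: true :: y)[t]?)
      x5 x4 x1 x2 (get_at _ _ _) (get_at1 _ _ _ _) (get_at _ _ _)
      (fun t a => get_ne _ _ _ _ t a) (get_at _ _ _) (fun t a => get_ne _ _ _ _ t a)
      (get_tail _ _ _ 1) g3 nu nv with b | b | b
    · exact Or.inl ⟨_, t1, b, by simp [gE_prefix, gE, e1]; omega⟩
    · exact Or.inr ⟨_, t2, b, by simp [gE_prefix, gE, e1]; omega⟩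
    · exact Or.inr ⟨_, t3, b, by simp [gE_prefix, gE, e1]; omega⟩
  · have e1 := gE_nonalt x y alt
    have t1 : TStep (p ++ true :: x) (p ++ false :: x) := TStep.repl p _ true
    have t2 : TStep (p ++ false :: y) (p ++ true :: y) := TStep.repl p _ false
    have key : (∀ j, ¬ Occ h k (fun t => (p ++ false :: x)[t]?) j) ∨
        ∀ j, ¬ Occ h k (fun t => (p ++ true :: y)[t]?) j := by
      by_cases hh : 1 ≤ h
      · by_cases hk : 1 ≤ k
        · exact core1 (i := p.length) hh hk
            (V := fun t => (p ++ false :: y)[t]?)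
            (U := fun t => (p ++ true :: x)[t]?)
            (fun t ht => get_lt p _ _ t ht) (get_at _ _ _) (get_at _ _ _) (get_at _ _ _)
            (fun t a => get_ne _ _ _ _ t a) (get_at _ _ _) (fun t a => get_ne _ _ _ _ t a)
            nu nv (by simpa only [get_tail] using alt)
        · left
          intro j oj
          have := occ_flip_false (i := p.length) (U := fun t => (p ++ true :: x)[t]?)
            (get_at _ _ _) (fun t a => get_ne _ _ _ _ t a) nu oj
          omega
      · right
        intro j oj
        have := occ_flip_true (i := p.length) (U := fun t => (p ++ false :: y)[t]?)
          (get_at _ _ _) (fun t a => get_ne _ _ _ _ t a) nv oj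
        omega
    rcases key with b | b
    · exact Or.inl ⟨_, t1, b, by simp [gE_prefix, gE, e1]; omega⟩
    · exact Or.inr ⟨_, t2, b, by simp [gE_prefix, gE, e1]; omega⟩

/-- The word `1^h 0^k` is tilde-isometric for all `h, k ≥ 0` except `h = k = 2`;
the word `1100` is tilde-non-isometric. -/
theorem tildeIsometric_ones_zeros :
    (∀ h k : ℕ, ¬(h = 2 ∧ k = 2) →
      TildeIsometric (List.replicate h true ++ List.replicate k false)) ∧
    ¬ TildeIsometric [true, true, false, false] := by
  refine ⟨fun h k h22 => iso_of_good ?_, not_iso⟩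
  intro u v hl hne hu hv
  obtain ⟨p, x, y, a, rfl, rfl⟩ := first_mismatch u v hl hne
  cases a with
  | true => exact good_main h22 p x y hu hv
  | false => exact (good_main h22 p y x hv hu).symm
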